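/- Let F be a loop, A an abelian group, and θ : F × F → A a loop cocycle. Then the loop Q(F,A,θ) is a left Bruck loop if and only if F is a left Bruck loop and both of the following identities hold: (i) θ(x,z) + θ(y,xz) + θ(x, y(xz)) = θ(y,x) + θ(x,yx) + θ(x(yx), z) for all x, y, z ∈ F; (ii) θ(x,x⁻¹) + θ(y,y⁻¹) = θ(x,y) + θ(x⁻¹,y⁻¹) + θ(xy, (xy)⁻¹) for all x, y ∈ F. -/

import Mathlib

/-- A loop: a binary operation with bijective left and right translations and a
two-sided identity element. -/
structure IsLoop {Q : Type*} (mul : Q → Q → Q) (e : Q) : Prop where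
  leftBij : ∀ x, Function.Bijective (fun y => mul x y)
  rightBij : ∀ x, Function.Bijective (fun y => mul y x)
  one_mul : ∀ x, mul e x = x
  mul_one : ∀ x, mul x e = x

/-- A left Bol loop: a loop satisfying the left Bol identity. -/
structure IsLeftBolLoop {Q : Type*} (mul : Q → Q → Q) (e : Q) extends IsLoop mul e : Prop where
  leftBol : ∀ x y z, mul x (mul y (mul x z)) = mul (mul x (mul y x)) z

/-- A left Bruck loop: a left Bol loop with two-sided inverses (given by `inv`)
satisfying the automorphic inverse property. -/
structure IsLeftBruckLoop {Q : Type*} (mul : Q → Q → Q) (e : Q) (inv : Q → Q)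
    extends IsLeftBolLoop mul e : Prop where
  mul_inv : ∀ x, mul x (inv x) = e
  inv_mul : ∀ x, mul (inv x) x = e
  aip : ∀ x y, inv (mul x y) = mul (inv x) (inv y)

/-- The multiplication of the central extension \`Q(F,A,θ)\`:
\`(x,a)(y,b) = (xy, a + b + θ(x,y))\`. -/
def qmul {F A : Type*} [AddCommGroup A] (mul : F → F → F) (θ : F → F → A) :
    F × A → F × A → F × A :=
  fun p q => (mul p.1 q.1, p.2 + q.2 + θ p.1 q.1)

section CentralExtension

variable {F A : Type*} [AddCommGroup A] {mul : F → F → F} {one : F} {θ : F → F → A}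

theorem IsLoop.qmul (hF : IsLoop mul one) (hθ : ∀ x, θ x one = 0 ∧ θ one x = 0) :
    IsLoop (qmul mul θ) (one, (0 : A)) where
  leftBij := by
    rintro ⟨x, a⟩
    constructor
    · rintro ⟨y, b⟩ ⟨z, c⟩ h
      obtain ⟨h₁, h₂⟩ := Prod.ext_iff.1 h
      obtain rfl : y = z := (hF.leftBij x).1 h₁
      simpa [_root_.qmul] using h₂
    · rintro ⟨z, c⟩
      obtain ⟨y, rfl⟩ := (hF.leftBij x).2 z
      exact ⟨(y, c - a - θ x y), Prod.ext rfl (by simp only [_root_.qmul]; abel)⟩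
  rightBij := by
    rintro ⟨x, a⟩
    constructor
    · rintro ⟨y, b⟩ ⟨z, c⟩ h
      obtain ⟨h₁, h₂⟩ := Prod.ext_iff.1 h
      obtain rfl : y = z := (hF.rightBij x).1 h₁
      simpa [_root_.qmul] using h₂
    · rintro ⟨z, c⟩
      obtain ⟨y, rfl⟩ := (hF.rightBij x).2 z
      exact ⟨(y, c - a - θ y x), Prod.ext rfl (by simp only [_root_.qmul]; abel)⟩
  one_mul x := by simp [_root_.qmul, hF.one_mul, hθ]
  mul_one x := by simp [_root_.qmul, hF.mul_one, hθ]

/-- The left Bol identity in `Q(F,A,θ)` splits into the one in `F` and a condition on `θ`. -/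
theorem qmul_leftBol_iff :
    (∀ p q r : F × A, qmul mul θ p (qmul mul θ q (qmul mul θ p r)) =
      qmul mul θ (qmul mul θ p (qmul mul θ q p)) r) ↔
    (∀ x y z, mul x (mul y (mul x z)) = mul (mul x (mul y x)) z) ∧
      ∀ x y z, θ x z + θ y (mul x z) + θ x (mul y (mul x z)) =
        θ y x + θ x (mul y x) + θ (mul x (mul y x)) z := by
  constructor
  · intro h
    refine ⟨fun x y z => congrArg Prod.fst (h (x, 0) (y, 0) (z, 0)), fun x y z => ?_⟩
    simpa [qmul, add_assoc] using congrArg Prod.snd (h (x, 0) (y, 0) (z, 0))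
  · rintro ⟨h₁, h₂⟩ ⟨x, a⟩ ⟨y, b⟩ ⟨z, c⟩
    refine Prod.ext (h₁ x y z) ?_
    linear_combination (norm := (simp only [qmul]; abel)) h₂ x y z

theorem qmul_eq_one_iff {p q : F × A} :
    qmul mul θ p q = (one, 0) ↔ mul p.1 q.1 = one ∧ q.2 = -p.2 - θ p.1 q.1 := by
  simp only [qmul, Prod.ext_iff]
  refine and_congr_right fun _ => ⟨fun h => ?_, fun h => ?_⟩
  · linear_combination (norm := abel) h
  · rw [h]; abel

end CentralExtension

/-- Corollary 5.3: for a loop `F`, an abelian group `A` and a loop cocycle `θ`,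
the loop `Q(F,A,θ)` is a left Bruck loop if and only if `F` is a left Bruck loop
and the identities `(5.1)` and `(5.3)` hold. -/
theorem qmul_bruck_iff {F A : Type*} [AddCommGroup A]
    (mul : F → F → F) (one : F) (hF : IsLoop mul one)
    (θ : F → F → A) (hθ : ∀ x, θ x one = 0 ∧ θ one x = 0) :
    (∃ qinv : F × A → F × A,
        IsLeftBruckLoop (qmul mul θ) (one, (0 : A)) qinv) ↔
    ((∃ finv : F → F, IsLeftBruckLoop mul one finv ∧
        ∀ x y, θ x (finv x) + θ y (finv y) =
          θ x y + θ (finv x) (finv y) + θ (mul x y) (finv (mul x y))) ∧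
      (∀ x y z, θ x z + θ y (mul x z) + θ x (mul y (mul x z)) =
        θ y x + θ x (mul y x) + θ (mul x (mul y x)) z)) := by
  constructor
  · rintro ⟨qinv, hQ⟩
    obtain ⟨bol, cocycle⟩ := qmul_leftBol_iff.1 hQ.leftBol
    have qinv_fst (p : F × A) : (qinv p).1 = (qinv (p.1, 0)).1 :=
      (hF.leftBij p.1).1 ((qmul_eq_one_iff.1 (hQ.mul_inv p)).1.trans
        (qmul_eq_one_iff.1 (hQ.mul_inv (p.1, 0))).1.symm)
    have qinv_snd (p : F × A) : (qinv p).2 = -p.2 - θ p.1 (qinv (p.1, 0)).1 := by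
      rw [← qinv_fst p]
      exact (qmul_eq_one_iff.1 (hQ.mul_inv p)).2
    refine ⟨⟨fun x => (qinv (x, 0)).1, ⟨⟨hF, bol⟩, fun x => ?_, fun x => ?_, fun x y => ?_⟩,
      fun x y => ?_⟩, cocycle⟩
    · exact congrArg Prod.fst (hQ.mul_inv (x, 0))
    · exact congrArg Prod.fst (hQ.inv_mul (x, 0))
    · exact (qinv_fst (qmul mul θ (x, 0) (y, 0))).symm.trans
        (congrArg Prod.fst (hQ.aip (x, 0) (y, 0)))
    · have h := congrArg Prod.snd (hQ.aip (x, 0) (y, 0))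
      simp only [qinv_snd, qmul] at h
      linear_combination (norm := abel) h
  · rintro ⟨⟨finv, hB, hinv⟩, cocycle⟩
    have θ_comm (x : F) : θ (finv x) x = θ x (finv x) := by
      have h := cocycle x (finv x) (finv x)
      simp only [hB.mul_inv, hB.inv_mul, hF.mul_one, hθ] at h
      linear_combination (norm := abel) -h
    refine ⟨fun p => (finv p.1, -p.2 - θ p.1 (finv p.1)),
      ⟨⟨hF.qmul hθ, qmul_leftBol_iff.2 ⟨hB.leftBol, cocycle⟩⟩, fun p => ?_, fun p => ?_,
        fun p q => ?_⟩⟩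
    · exact qmul_eq_one_iff.2 ⟨hB.mul_inv _, rfl⟩
    · refine qmul_eq_one_iff.2 ⟨hB.inv_mul _, ?_⟩
      simp only [θ_comm]; abel
    · refine Prod.ext (hB.aip _ _) ?_
      linear_combination (norm := (simp only [qmul]; abel)) hinv p.1 q.1
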